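/- Let n ≥ 3, let α, β, γ, ν be real numbers and 1 < p < ∞. Assume that the parameters satisfy: (i) γ = α + β + n/2 − ν/p; (ii) ν < p(β + 1) + n/2 − 1; (iii) p(α − n/2 + 1) > −n/2 + 1. Then the operator S = S_{α,β,γ} is bounded from L^p_ν(Λ_n) into L^∞(Λ_n); more precisely, there is C > 0 such that sup_{y∈Λ_n} S|g|(y) ≤ C ‖g‖_{p,ν} for every g ∈ L^p_ν(Λ_n). (This is the sufficiency lemma, Lemma 4.3 of the paper, instantiated on the rank-2 Lorentz cone, where n/r = n/2.) -/

import Mathlib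

open MeasureTheory ENNReal

noncomputable section

/-- The Lorentz determinant `Δ(y) = y₁² − y₂² − ⋯ − y_n²`. -/
def lDelta (n : ℕ) [NeZero n] (y : Fin n → ℝ) : ℝ :=
  2 * y 0 ^ 2 - ∑ i, y i ^ 2

/-- The Lorentz cone `Λ_n`. -/
def lCone (n : ℕ) [NeZero n] : Set (Fin n → ℝ) :=
  {y | 0 < lDelta n y ∧ 0 < y 0}

/-- The `L^p_ν(Λ_n)` norm `(∫_{Λ_n} |g(y)|^p Δ(y)^{ν−n/2} dy)^{1/p}`. -/
def coneNorm (n : ℕ) [NeZero n] (p ν : ℝ) (g : (Fin n → ℝ) → ℝ) : ℝ≥0∞ :=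
  (∫⁻ y in lCone n, ENNReal.ofReal (|g y| ^ p * lDelta n y ^ (ν - (n : ℝ) / 2))) ^ (1 / p)

/-- The operator `S_{α,β,γ}` applied to `|g|`:
`S|g|(y) = Δ(y)^α ∫_{Λ_n} Δ(y+x)^{−γ} |g(x)| Δ(x)^β dx`. -/
def Sop (n : ℕ) [NeZero n] (α β γ : ℝ) (g : (Fin n → ℝ) → ℝ) (y : Fin n → ℝ) : ℝ≥0∞ :=
  ENNReal.ofReal (lDelta n y ^ α) *
    ∫⁻ x in lCone n, ENNReal.ofReal (lDelta n (y + x) ^ (-γ) * |g x| * lDelta n x ^ β)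

/-- The `L^q_μ(Λ_n)` norm of `S_{α,β,γ}|g|`. -/
def SopNorm (n : ℕ) [NeZero n] (α β γ q μ : ℝ) (g : (Fin n → ℝ) → ℝ) : ℝ≥0∞ :=
  (∫⁻ y in lCone n, Sop n α β γ g y ^ q * ENNReal.ofReal (lDelta n y ^ (μ - (n : ℝ) / 2))) ^ (1 / q)

/-- `S_{α,β,γ}` is bounded from `L^p_ν(Λ_n)` to `L^q_μ(Λ_n)`:
`‖S|g|‖_{q,μ} ≤ C ‖g‖_{p,ν}` for every `g ∈ L^p_ν(Λ_n)`. -/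
def SBounded (n : ℕ) [NeZero n] (α β γ p ν q μ : ℝ) : Prop :=
  ∃ C > (0 : ℝ), ∀ g : (Fin n → ℝ) → ℝ, Measurable g → coneNorm n p ν g < ⊤ →
    SopNorm n α β γ q μ g ≤ ENNReal.ofReal C * coneNorm n p ν g

/-- `S_{α,β,γ}` is bounded from `L^p_ν(Λ_n)` to `L^∞(Λ_n)`:
`sup_{y∈Λ_n} S|g|(y) ≤ C ‖g‖_{p,ν}` for every `g ∈ L^p_ν(Λ_n)`. -/
def SBoundedSup (n : ℕ) [NeZero n] (α β γ p ν : ℝ) : Prop :=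
  ∃ C > (0 : ℝ), ∀ g : (Fin n → ℝ) → ℝ, Measurable g → coneNorm n p ν g < ⊤ →
    ∀ y ∈ lCone n, Sop n α β γ g y ≤ ENNReal.ofReal C * coneNorm n p ν g

theorem integrableOn_Ioi_rpow_mul_one_add_rpow {c a : ℝ} (hc : -1 < c) (ha : c + 1 < a) :
    IntegrableOn (fun u : ℝ => u ^ c * (1 + u) ^ (-a)) (Set.Ioi 0) := by
  have hmeas : Measurable fun u : ℝ => u ^ c * (1 + u) ^ (-a) := by fun_prop
  rw [← Set.Ioc_union_Ioi_eq_Ioi zero_le_one]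
  refine IntegrableOn.union ?_ ?_
  · have h := (intervalIntegral.intervalIntegrable_rpow' (a := 0) (b := 1) hc)
    rw [intervalIntegrable_iff_integrableOn_Ioc_of_le zero_le_one] at h
    refine Integrable.mono' h hmeas.aestronglyMeasurable ?_
    filter_upwards [ae_restrict_mem measurableSet_Ioc] with u hu
    have hu0 : 0 < u := hu.1
    rw [Real.norm_of_nonneg (by positivity)]
    exact mul_le_of_le_one_right (by positivity)
      (Real.rpow_le_one_of_one_le_of_nonpos (by linarith) (by linarith))
  · refine Integrable.mono' (integrableOn_Ioi_rpow_of_lt (a := c - a) (by linarith) zero_lt_one)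
      hmeas.aestronglyMeasurable ?_
    filter_upwards [ae_restrict_mem measurableSet_Ioi] with u hu
    have hu0 : 0 < u := lt_trans zero_lt_one hu
    rw [Real.norm_of_nonneg (by positivity), sub_eq_add_neg, Real.rpow_add hu0]
    exact mul_le_mul_of_nonneg_left
      (Real.rpow_le_rpow_of_nonpos hu0 (by linarith) (by linarith)) (by positivity)

section LorentzCone

variable {n : ℕ} [NeZero n]

/-- The Lorentz bilinear form. -/
def lForm (n : ℕ) [NeZero n] (x y : Fin n → ℝ) : ℝ := 2 * (x 0 * y 0) - ∑ i, x i * y i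

theorem lForm_self (x : Fin n → ℝ) : lForm n x x = lDelta n x := by
  simp only [lForm, lDelta, sq]

theorem lForm_comm (x y : Fin n → ℝ) : lForm n x y = lForm n y x := by
  simp only [lForm, mul_comm]

theorem lForm_add_left (x y z : Fin n → ℝ) : lForm n (x + y) z = lForm n x z + lForm n y z := by
  simp only [lForm, Pi.add_apply, add_mul, Finset.sum_add_distrib]
  ring

theorem lForm_smul_left (c : ℝ) (x z : Fin n → ℝ) : lForm n (c • x) z = c * lForm n x z := by
  simp only [lForm, Pi.smul_apply, smul_eq_mul, mul_assoc, ← Finset.mul_sum]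
  ring

theorem lForm_sub_left (x y z : Fin n → ℝ) : lForm n (x - y) z = lForm n x z - lForm n y z := by
  simp only [lForm, Pi.sub_apply, sub_mul, Finset.sum_sub_distrib]
  ring

theorem lForm_add_right (x y z : Fin n → ℝ) : lForm n x (y + z) = lForm n x y + lForm n x z := by
  simp only [lForm_comm x, lForm_add_left]

theorem lForm_smul_right (c : ℝ) (x z : Fin n → ℝ) : lForm n x (c • z) = c * lForm n x z := by
  simp only [lForm_comm x, lForm_smul_left]

theorem lForm_sub_right (x y z : Fin n → ℝ) : lForm n x (y - z) = lForm n x y - lForm n x z := by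
  simp only [lForm_comm x, lForm_sub_left]

theorem lForm_single_right (x : Fin n → ℝ) : lForm n x (Pi.single 0 1) = x 0 := by
  simp [lForm, Pi.single_apply]
  ring

/-- The reversed Cauchy-Schwarz inequality, in its weak form. -/
theorem lForm_pos {x y : Fin n → ℝ} (hx : x ∈ lCone n) (hy : y ∈ lCone n) : 0 < lForm n x y := by
  obtain ⟨hx1, hx0⟩ := hx
  obtain ⟨hy1, hy0⟩ := hy
  have h : 0 ≤ ∑ i, (x 0 * y i - y 0 * x i) ^ 2 := Finset.sum_nonneg fun i _ => sq_nonneg _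
  have h' : ∑ i, (x 0 * y i - y 0 * x i) ^ 2 = x 0 ^ 2 * ∑ i, y i ^ 2
      - 2 * (x 0 * y 0) * ∑ i, x i * y i + y 0 ^ 2 * ∑ i, x i ^ 2 := by
    simp only [Finset.mul_sum, ← Finset.sum_sub_distrib, ← Finset.sum_add_distrib]
    exact Finset.sum_congr rfl fun i _ => by ring
  unfold lDelta at hx1 hy1
  unfold lForm
  have hxy := mul_pos hx0 hy0
  have h1 := mul_pos (pow_pos hx0 2) hy1
  have h2 := mul_pos (pow_pos hy0 2) hx1
  have h3 : 0 < 2 * (x 0 * y 0) * (2 * (x 0 * y 0) - ∑ i, x i * y i) := by nlinarith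
  exact pos_of_mul_pos_right h3 (by positivity)

theorem single_mem_lCone : (Pi.single 0 1 : Fin n → ℝ) ∈ lCone n := by
  have := lForm_single_right (n := n) (Pi.single 0 1)
  rw [lForm_self] at this
  simp [lCone, this]

theorem lDelta_add (x y : Fin n → ℝ) :
    lDelta n (x + y) = lDelta n x + 2 * lForm n x y + lDelta n y := by
  simp only [← lForm_self, lForm_add_left, lForm_add_right, lForm_comm y x]
  ring

theorem lDelta_smul (c : ℝ) (x : Fin n → ℝ) : lDelta n (c • x) = c ^ 2 * lDelta n x := by
  simp only [← lForm_self, lForm_smul_left, lForm_smul_right]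
  ring

theorem add_mem_lCone {x y : Fin n → ℝ} (hx : x ∈ lCone n) (hy : y ∈ lCone n) :
    x + y ∈ lCone n :=
  ⟨by rw [lDelta_add]; linarith [hx.1, hy.1, lForm_pos hx hy], add_pos hx.2 hy.2⟩

theorem smul_mem_lCone {c : ℝ} (hc : 0 < c) {x : Fin n → ℝ} (hx : x ∈ lCone n) :
    c • x ∈ lCone n :=
  ⟨by rw [lDelta_smul]; exact mul_pos (by positivity) hx.1, mul_pos hc hx.2⟩

@[fun_prop]
theorem measurable_lDelta : Measurable (lDelta n) := by
  unfold lDelta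
  fun_prop

theorem measurableSet_lCone : MeasurableSet (lCone n) :=
  (measurableSet_lt measurable_const measurable_lDelta).inter
    (measurableSet_lt measurable_const (measurable_pi_apply 0))

/-- The Lorentz half-turn about the axis spanned by `w`. -/
def lHalfTurn (w : Fin n → ℝ) : (Fin n → ℝ) →ₗ[ℝ] (Fin n → ℝ) where
  toFun x := (2 * lForm n x w / lDelta n w) • w - x
  map_add' x y := by
    ext i
    simp only [lForm_add_left, Pi.sub_apply, Pi.smul_apply, Pi.add_apply, smul_eq_mul]
    ring
  map_smul' c x := by
    ext i
    simp only [lForm_smul_left, Pi.sub_apply, Pi.smul_apply, smul_eq_mul, RingHom.id_apply]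
    ring

theorem lHalfTurn_apply (w x : Fin n → ℝ) :
    lHalfTurn w x = (2 * lForm n x w / lDelta n w) • w - x := rfl

theorem lForm_lHalfTurn {w : Fin n → ℝ} (hw : lDelta n w ≠ 0) (x y : Fin n → ℝ) :
    lForm n (lHalfTurn w x) (lHalfTurn w y) = lForm n x y := by
  simp only [lHalfTurn_apply, lForm_sub_left, lForm_sub_right, lForm_smul_left, lForm_smul_right,
    lForm_self, lForm_comm w y]
  field_simp
  ring

theorem lDelta_lHalfTurn {w : Fin n → ℝ} (hw : lDelta n w ≠ 0) (x : Fin n → ℝ) :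
    lDelta n (lHalfTurn w x) = lDelta n x := by
  simp only [← lForm_self, lForm_lHalfTurn hw]

theorem lHalfTurn_lHalfTurn {w : Fin n → ℝ} (hw : lDelta n w ≠ 0) (x : Fin n → ℝ) :
    lHalfTurn w (lHalfTurn w x) = x := by
  ext i
  simp only [lHalfTurn_apply, lForm_sub_left, lForm_smul_left, lForm_self, Pi.sub_apply,
    Pi.smul_apply, smul_eq_mul]
  field_simp
  ring

theorem abs_det_lHalfTurn {w : Fin n → ℝ} (hw : lDelta n w ≠ 0) :
    |LinearMap.det (lHalfTurn w)| = 1 := by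
  have h : lHalfTurn w * lHalfTurn w = 1 := LinearMap.ext fun x => lHalfTurn_lHalfTurn hw x
  have h2 : LinearMap.det (lHalfTurn w) * LinearMap.det (lHalfTurn w) = 1 := by
    rw [← map_mul, h, map_one]
  rcases mul_self_eq_one_iff.1 h2 with h | h <;> simp [h]

theorem lHalfTurn_mem_lCone {w : Fin n → ℝ} (hw : w ∈ lCone n) {x : Fin n → ℝ}
    (hx : x ∈ lCone n) : lHalfTurn w x ∈ lCone n := by
  have hw0 := hw.1.ne'
  refine ⟨by rw [lDelta_lHalfTurn hw0]; exact hx.1, ?_⟩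
  have key : lForm n x (lHalfTurn w (Pi.single 0 1)) = lHalfTurn w x 0 := by
    rw [← lForm_single_right (lHalfTurn w x), ← lForm_lHalfTurn hw0, lHalfTurn_lHalfTurn hw0]
  rw [← key]
  refine lForm_pos hx ⟨?_, ?_⟩
  · rw [lDelta_lHalfTurn hw0]
    exact single_mem_lCone.1
  · have h : lDelta n w ≤ w 0 ^ 2 := by
      have := Finset.single_le_sum (f := fun i => w i ^ 2) (fun i _ => sq_nonneg _)
        (Finset.mem_univ 0)
      simp only [lDelta]
      linarith
    rw [lHalfTurn_apply, lForm_comm, lForm_single_right]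
    simp only [Pi.sub_apply, Pi.smul_apply, smul_eq_mul, Pi.single_eq_same, sub_pos]
    rw [div_mul_eq_mul_div, one_lt_div hw.1]
    nlinarith [hw.1]

/-- Homogeneity of the integral `∫ Δ(x+y)^{-a} Δ(x)^b dx` in `y`. -/
theorem setLIntegral_lCone_eq (a b : ℝ) {y : Fin n → ℝ} (hy : y ∈ lCone n) :
    ∫⁻ x in lCone n, ENNReal.ofReal (lDelta n (y + x) ^ (-a) * lDelta n x ^ b) =
      ENNReal.ofReal (lDelta n y ^ (b + (n : ℝ) / 2 - a)) *
        ∫⁻ x in lCone n, ENNReal.ofReal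
          (lDelta n (Pi.single 0 1 + x) ^ (-a) * lDelta n x ^ b) := by
  set s := √(lDelta n y) with hs
  have hs0 : 0 < s := Real.sqrt_pos.2 hy.1
  have hs2 : s ^ 2 = lDelta n y := Real.sq_sqrt hy.1.le
  set e : Fin n → ℝ := Pi.single 0 1 with he
  have hee : lDelta n e = 1 := by
    rw [← lForm_self, he, lForm_single_right]; simp
  set w := y + s • e with hw_def
  have hw : w ∈ lCone n := add_mem_lCone hy (smul_mem_lCone hs0 single_mem_lCone)
  have hw0 := hw.1.ne'
  set L := s • lHalfTurn w with hL
  have hLe : L e = y := by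
    have h1 : lForm n e w = y 0 + s := by
      rw [lForm_comm, lForm_single_right]
      simp [hw_def, he]
    have h2 : lDelta n w = 2 * s * (y 0 + s) := by
      rw [hw_def, lDelta_add, lDelta_smul, lForm_smul_right, lForm_single_right, ← hs2, hee]
      ring
    have h3 : y 0 + s ≠ 0 := (add_pos hy.2 hs0).ne'
    rw [hL, LinearMap.smul_apply, lHalfTurn_apply, h1, h2]
    ext i
    simp only [Pi.smul_apply, Pi.sub_apply, smul_eq_mul, hw_def, Pi.add_apply]
    field_simp
    ring
  have hdet : |LinearMap.det L| = s ^ n := by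
    rw [hL, LinearMap.det_smul, abs_mul, abs_det_lHalfTurn hw0, Module.finrank_fin_fun, mul_one,
      abs_of_pos (by positivity)]
  have hdet0 : LinearMap.det L ≠ 0 := by
    rw [← abs_pos, hdet]; positivity
  have hLd : ∀ x, lDelta n (L x) = s ^ 2 * lDelta n x := fun x => by
    rw [hL, LinearMap.smul_apply, lDelta_smul, lDelta_lHalfTurn hw0]
  have hLc : ∀ x, L x ∈ lCone n ↔ x ∈ lCone n := fun x => by
    refine ⟨fun h => ?_, fun h => smul_mem_lCone hs0 (lHalfTurn_mem_lCone hw h)⟩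
    have h2 := lHalfTurn_mem_lCone hw (smul_mem_lCone (inv_pos.2 hs0) h)
    rwa [hL, LinearMap.smul_apply, smul_smul, inv_mul_cancel₀ hs0.ne', one_smul,
      lHalfTurn_lHalfTurn hw0] at h2
  set F : (Fin n → ℝ) → ℝ≥0∞ := (lCone n).indicator
    fun x => ENNReal.ofReal (lDelta n (y + x) ^ (-a) * lDelta n x ^ b) with hF
  have hFm : Measurable F := Measurable.indicator (by fun_prop) measurableSet_lCone
  have hmap := Measure.map_linearMap_addHaar_eq_smul_addHaar
    (volume : Measure (Fin n → ℝ)) hdet0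
  have hchange : ∫⁻ x, F x = ENNReal.ofReal (s ^ n) * ∫⁻ x, F (L x) := by
    have h := lintegral_map (μ := volume) hFm (L.continuous_of_finiteDimensional.measurable)
    rw [hmap, lintegral_smul_measure] at h
    rw [← h, smul_eq_mul, ← mul_assoc, ← ENNReal.ofReal_mul (by positivity), abs_inv, hdet,
      mul_inv_cancel₀ (by positivity), ENNReal.ofReal_one, one_mul]
  rw [← lintegral_indicator measurableSet_lCone, ← hF, hchange,
    ← lintegral_indicator measurableSet_lCone]
  have hFL : ∀ x, F (L x) = ENNReal.ofReal ((s ^ 2) ^ (b - a)) *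
      (lCone n).indicator (fun x => ENNReal.ofReal (lDelta n (e + x) ^ (-a) * lDelta n x ^ b)) x :=
    fun x => by
      by_cases hx : x ∈ lCone n
      · have hex := (add_mem_lCone (single_mem_lCone) hx).1
        rw [← he] at hex
        have hx1 := hx.1
        rw [hF, Set.indicator_of_mem ((hLc x).2 hx), Set.indicator_of_mem hx,
          ← ENNReal.ofReal_mul (by positivity)]
        congr 1
        have : y + L x = L (e + x) := by rw [map_add, hLe]
        rw [this, hLd, hLd, Real.mul_rpow (by positivity) hex.le,
          Real.mul_rpow (by positivity) hx1.le, sub_eq_neg_add,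
          Real.rpow_add (by positivity) (-a) b]
        ring
      · rw [hF, Set.indicator_of_notMem (mt (hLc x).1 hx), Set.indicator_of_notMem hx, mul_zero]
  simp_rw [hFL]
  rw [lintegral_const_mul _ (Measurable.indicator (by fun_prop) measurableSet_lCone),
    ← mul_assoc, ← ENNReal.ofReal_mul (by positivity), hs2]
  congr 2
  have : s ^ n = lDelta n y ^ ((n : ℝ) / 2) := by
    rw [hs, Real.sqrt_eq_rpow, ← Real.rpow_natCast, ← Real.rpow_mul hy.1.le]
    ring_nf
  rw [this, ← Real.rpow_add hy.1]
  ring_nf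

theorem integrable_norm_rpow_mul_one_add_norm_rpow {m : ℕ} (hm : 1 ≤ m) {c a : ℝ}
    (hc : -m < c) (ha : c + m < a) :
    Integrable fun x : Fin m → ℝ => ‖x‖ ^ c * (1 + ‖x‖) ^ (-a) := by
  have : NeZero m := ⟨by omega⟩
  refine (integrable_fun_norm_addHaar volume (f := fun r : ℝ => r ^ c * (1 + r) ^ (-a))).2 ?_
  have h := integrableOn_Ioi_rpow_mul_one_add_rpow (c := (m - 1 : ℕ) + c) (a := a)
    (by push_cast [hm]; linarith) (by push_cast [hm]; linarith)
  refine h.congr_fun (fun y hy => ?_) measurableSet_Ioi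
  simp only [Module.finrank_fin_fun, smul_eq_mul]
  rw [Real.rpow_add hy, Real.rpow_natCast, mul_assoc]

/-- The kernel estimate in the light-cone coordinates `u = t - |x'|`, `v = t + |x'|`. -/
theorem rpow_mul_rpow_le_of_le {a b u v ρ : ℝ} (ha : max b 0 ≤ a) (hu : 0 < u) (hρ : 0 < ρ)
    (hv : ρ ≤ v) :
    ((1 + u) * (1 + v)) ^ (-a) * (u * v) ^ b ≤
      u ^ b * (1 + u) ^ (-a) * (ρ ^ min b 0 * (1 + ρ) ^ (-(a - max b 0))) := by
  have hv0 : 0 < v := hρ.trans_le hv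
  have h1 : v ^ min b 0 ≤ ρ ^ min b 0 := Real.rpow_le_rpow_of_nonpos hρ hv (min_le_right _ _)
  have h2 : v ^ max b 0 ≤ (1 + v) ^ max b 0 :=
    Real.rpow_le_rpow hv0.le (by linarith) (le_max_right _ _)
  have h3 : (1 + v) ^ (-(a - max b 0)) ≤ (1 + ρ) ^ (-(a - max b 0)) :=
    Real.rpow_le_rpow_of_nonpos (by linarith) (by linarith) (by linarith)
  have h4 : v ^ b = v ^ min b 0 * v ^ max b 0 := by
    rw [← Real.rpow_add hv0, min_add_max, add_zero]
  have h5 : (1 + v) ^ (-(a - max b 0)) = (1 + v) ^ max b 0 * (1 + v) ^ (-a) := by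
    rw [← Real.rpow_add (by linarith)]
    ring_nf
  rw [Real.mul_rpow (by linarith) (by linarith), Real.mul_rpow hu.le hv0.le, h4]
  calc (1 + u) ^ (-a) * (1 + v) ^ (-a) * (u ^ b * (v ^ min b 0 * v ^ max b 0))
      = u ^ b * (1 + u) ^ (-a) * (v ^ min b 0 * (v ^ max b 0 * (1 + v) ^ (-a))) := by ring
    _ ≤ u ^ b * (1 + u) ^ (-a) * (ρ ^ min b 0 * ((1 + v) ^ max b 0 * (1 + v) ^ (-a))) := by
        gcongr
    _ ≤ _ := by
        rw [← h5]
        gcongr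

theorem setLIntegral_lCone_lt_top (hn : 2 ≤ n) {a b : ℝ} (hb : -1 < b) (ha : b + n - 1 < a) :
    ∫⁻ x in lCone n, ENNReal.ofReal
      (lDelta n (Pi.single 0 1 + x) ^ (-a) * lDelta n x ^ b) < ⊤ := by
  obtain ⟨m, rfl⟩ : ∃ m, n = m + 1 := ⟨n - 1, by omega⟩
  have hm : 1 ≤ m := by omega
  have hm' : (1 : ℝ) ≤ m := by exact_mod_cast hm
  have : NeZero m := ⟨by omega⟩
  push_cast at ha
  have hmax : max b 0 ≤ a := max_le (by linarith) (by linarith)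
  have hadd : min b 0 + max b 0 = b := by rw [min_add_max, add_zero]
  set e : Fin (m + 1) → ℝ := Pi.single 0 1 with he
  set F : (Fin (m + 1) → ℝ) → ℝ≥0∞ := (lCone (m + 1)).indicator
    fun x => ENNReal.ofReal (lDelta (m + 1) (e + x) ^ (-a) * lDelta (m + 1) x ^ b) with hF
  have hFm : Measurable F := Measurable.indicator (by fun_prop) measurableSet_lCone
  set f : ℝ → ℝ≥0∞ := (Set.Ioi 0).indicator
    fun u => ENNReal.ofReal (u ^ b * (1 + u) ^ (-a)) with hf
  set g : (Fin m → ℝ) → ℝ≥0∞ :=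
    fun x => ENNReal.ofReal (‖x‖ ^ min b 0 * (1 + ‖x‖) ^ (-(a - max b 0))) with hg
  have hfm : Measurable f := Measurable.indicator (by fun_prop) measurableSet_Ioi
  have hgm : Measurable g := by fun_prop
  have hfi : ∫⁻ u, f u < ⊤ := by
    rw [hf, lintegral_indicator measurableSet_Ioi]
    exact (integrableOn_Ioi_rpow_mul_one_add_rpow hb (by linarith)).lintegral_lt_top
  have hmin : -(m : ℝ) < min b 0 := lt_min (by linarith) (by linarith)
  have hgi : ∫⁻ x, g x < ⊤ :=
    (integrable_norm_rpow_mul_one_add_norm_rpow hm hmin (by linarith)).lintegral_lt_top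
  let r : (Fin m → ℝ) → ℝ := fun x => √(∑ i, x i ^ 2)
  let Φ := MeasurableEquiv.piFinSuccAbove (fun _ : Fin (m + 1) => ℝ) 0
  have hΦ := volume_preserving_piFinSuccAbove (fun _ : Fin (m + 1) => ℝ) 0
  have hΔ : ∀ t x, lDelta (m + 1) (Φ.symm (t, x)) = (t - r x) * (t + r x) := fun t x => by
    have hr : r x ^ 2 = ∑ i, x i ^ 2 := Real.sq_sqrt (Finset.sum_nonneg fun i _ => sq_nonneg _)
    simp only [lDelta, Fin.sum_univ_succ, Φ, MeasurableEquiv.piFinSuccAbove_symm_apply,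
      Fin.insertNthEquiv_zero, Fin.consEquiv_apply, Fin.cons_zero, Fin.cons_succ, ← hr]
    ring
  have hΔe : ∀ t x, lDelta (m + 1) (e + Φ.symm (t, x)) = (1 + (t - r x)) * (1 + (t + r x)) :=
    fun t x => by
      have : e + Φ.symm (t, x) = Φ.symm (1 + t, x) := by
        ext i
        refine Fin.cases ?_ (fun j => ?_) i <;>
        simp [e, Φ, MeasurableEquiv.piFinSuccAbove_symm_apply]
      rw [this, hΔ]
      ring
  have hle : ∀ x ≠ 0, ∀ t, F (Φ.symm (t, x)) ≤ f (t - r x) * g x := fun x hx t => by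
    by_cases h : Φ.symm (t, x) ∈ lCone (m + 1)
    · have hr0 : 0 ≤ r x := Real.sqrt_nonneg _
      have ht : 0 < t := by
        simpa [Φ, MeasurableEquiv.piFinSuccAbove_symm_apply] using h.2
      have h1 := h.1
      rw [hΔ] at h1
      have hu : 0 < t - r x := pos_of_mul_pos_left h1 (by linarith)
      have hρ : ‖x‖ ≤ t + r x := by
        refine le_trans ((pi_norm_le_iff_of_nonneg hr0).2 fun i => ?_) (by linarith)
        refine Real.abs_le_sqrt ?_
        exact Finset.single_le_sum (f := fun i => x i ^ 2) (fun i _ => sq_nonneg _)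
          (Finset.mem_univ i)
      rw [hF, Set.indicator_of_mem h, hf, Set.indicator_of_mem (Set.mem_Ioi.2 hu), hg, hΔ, hΔe,
        ← ENNReal.ofReal_mul (by positivity)]
      exact ENNReal.ofReal_le_ofReal (rpow_mul_rpow_le_of_le hmax hu (norm_pos_iff.2 hx) hρ)
    · rw [hF, Set.indicator_of_notMem h]
      exact zero_le
  rw [← lintegral_indicator measurableSet_lCone, ← hF]
  calc ∫⁻ x, F x = ∫⁻ z, F (Φ.symm z) := hΦ.symm.lintegral_map_equiv F Φ.symm
    _ = ∫⁻ x, ∫⁻ t, F (Φ.symm (t, x)) :=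
        lintegral_prod_symm _ (hFm.comp Φ.symm.measurable).aemeasurable
    _ ≤ ∫⁻ x, (∫⁻ u, f u) * g x := by
        refine lintegral_mono_ae ?_
        filter_upwards [Measure.ae_ne volume (0 : Fin m → ℝ)] with x hx
        rw [← lintegral_sub_right_eq_self f (r x)]
        exact (lintegral_mono (hle x hx)).trans_eq
          (lintegral_mul_const _ (hfm.comp (measurable_id.sub_const _)))
    _ = (∫⁻ u, f u) * ∫⁻ x, g x := lintegral_const_mul _ hgm
    _ < ⊤ := ENNReal.mul_lt_top hfi hgi

end LorentzCone

/-- Lemma 4.3 of the paper on the rank-2 Lorentz cone (sufficiency, target `L^∞`). -/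
theorem statement12 (n : ℕ) [NeZero n] (hn : 3 ≤ n) (α β γ ν p : ℝ)
    (hp : 1 < p)
    (h1 : γ = α + β + (n : ℝ) / 2 - ν / p)
    (h2 : ν < p * (β + 1) + (n : ℝ) / 2 - 1)
    (h3 : p * (α - (n : ℝ) / 2 + 1) > -((n : ℝ) / 2) + 1) :
    SBoundedSup n α β γ p ν := by
  set N : ℝ := (n : ℝ) / 2 with hN
  set q := p.conjExponent with hq
  have hpq : p.HolderConjugate q := .conjExponent hp
  have hp0 : 0 < p := hpq.pos
  have hq0 : 0 < q := hpq.symm.pos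
  set δ := (ν - N) / p with hδ
  have hpδ : δ * p = ν - N := div_mul_cancel₀ _ hp0.ne'
  have hqinv : 1 / q = 1 - 1 / p := by
    rw [one_div, one_div, ← hpq.inv_add_inv_eq_one]
    ring
  have hνp : ν / p = δ + N * (1 / p) := by
    rw [hδ]
    ring
  have hb : -1 < (β - δ) * q := by
    have h : 0 < β - δ + 1 / q := by
      rw [hqinv]
      refine pos_of_mul_pos_left (b := p) ?_ hp0.le
      have : (β - δ + (1 - 1 / p)) * p = β * p - δ * p + p - 1 := by
        field_simp
        ring
      rw [this, hpδ]
      linarith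
    have h' := mul_pos h hq0
    rw [add_mul, one_div_mul_cancel hq0.ne'] at h'
    linarith
  have hexp : (β - δ) * q + N - γ * q = -α * q := by
    have : N = N * (1 / q) * q := by field_simp
    rw [this, h1, hνp, hqinv]
    ring
  have hα : N - 1 < α * q := by
    have h : (N - 1) * (1 / q) < α := by
      rw [hqinv]
      refine lt_of_mul_lt_mul_right ?_ hp0.le
      have : (N - 1) * (1 - 1 / p) * p = (N - 1) * (p - 1) := by field_simp
      rw [this]
      linarith
    have h' := mul_lt_mul_of_pos_right h hq0
    rwa [mul_assoc, one_div_mul_cancel hq0.ne', mul_one] at h'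
  set J := ∫⁻ x in lCone n, ENNReal.ofReal
    (lDelta n (Pi.single 0 1 + x) ^ (-(γ * q)) * lDelta n x ^ ((β - δ) * q)) with hJ
  have hJt : J < ⊤ := setLIntegral_lCone_lt_top (by omega) hb (by linarith)
  have hJq : J ^ (1 / q) ≠ ⊤ := ENNReal.rpow_ne_top_of_nonneg (by positivity) hJt.ne
  refine ⟨(J ^ (1 / q)).toReal + 1, by positivity, fun g hg _ y hy => ?_⟩
  have hholder := ENNReal.lintegral_mul_le_Lp_mul_Lq (volume.restrict (lCone n)) hpq
    (f := fun x => ENNReal.ofReal (|g x| * lDelta n x ^ δ))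
    (g := fun x => ENNReal.ofReal (lDelta n (y + x) ^ (-γ) * lDelta n x ^ (β - δ)))
    (by fun_prop) (by fun_prop)
  have hleft : ∫⁻ x in lCone n,
        ENNReal.ofReal (lDelta n (y + x) ^ (-γ) * |g x| * lDelta n x ^ β) =
      ∫⁻ x in lCone n, ((fun x => ENNReal.ofReal (|g x| * lDelta n x ^ δ)) *
        (fun x => ENNReal.ofReal (lDelta n (y + x) ^ (-γ) * lDelta n x ^ (β - δ)))) x := by
    refine setLIntegral_congr_fun measurableSet_lCone fun x hx => ?_
    have hx1 := hx.1
    simp only [Pi.mul_apply]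
    rw [← ENNReal.ofReal_mul (by positivity)]
    congr 1
    have : lDelta n x ^ β = lDelta n x ^ δ * lDelta n x ^ (β - δ) := by
      rw [← Real.rpow_add hx1, add_sub_cancel]
    rw [this]
    ring
  have hnorm : (∫⁻ x in lCone n, ENNReal.ofReal (|g x| * lDelta n x ^ δ) ^ p) ^ (1 / p) =
      coneNorm n p ν g := by
    unfold coneNorm
    congr 1
    refine setLIntegral_congr_fun measurableSet_lCone fun x hx => ?_
    have hx1 := hx.1
    rw [ENNReal.ofReal_rpow_of_nonneg (by positivity) hp0.le,
      Real.mul_rpow (by positivity) (by positivity), ← Real.rpow_mul hx1.le, hpδ]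
  have hkernel : (∫⁻ x in lCone n,
        ENNReal.ofReal (lDelta n (y + x) ^ (-γ) * lDelta n x ^ (β - δ)) ^ q) ^ (1 / q) =
      ENNReal.ofReal (lDelta n y ^ (-α)) * J ^ (1 / q) := by
    have hy1 := hy.1
    have : ∫⁻ x in lCone n,
        ENNReal.ofReal (lDelta n (y + x) ^ (-γ) * lDelta n x ^ (β - δ)) ^ q =
        ENNReal.ofReal (lDelta n y ^ (-α * q)) * J := by
      rw [← hexp, hN, ← setLIntegral_lCone_eq _ _ hy]
      refine setLIntegral_congr_fun measurableSet_lCone fun x hx => ?_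
      have hx1 := hx.1
      have hxy := (add_mem_lCone hy hx).1
      rw [ENNReal.ofReal_rpow_of_nonneg (by positivity) hq0.le,
        Real.mul_rpow (by positivity) (by positivity), ← Real.rpow_mul hx1.le,
        ← Real.rpow_mul hxy.le, neg_mul]
    rw [this, ENNReal.mul_rpow_of_nonneg _ _ (by positivity),
      ENNReal.ofReal_rpow_of_nonneg (by positivity) (by positivity), ← Real.rpow_mul hy1.le,
      mul_assoc, mul_one_div_cancel hq0.ne', mul_one]
  have hcancel : ENNReal.ofReal (lDelta n y ^ α) * ENNReal.ofReal (lDelta n y ^ (-α)) = 1 := by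
    have hy1 := hy.1
    rw [← ENNReal.ofReal_mul (by positivity), ← Real.rpow_add hy1, add_neg_cancel,
      Real.rpow_zero, ENNReal.ofReal_one]
  rw [← hleft, hnorm, hkernel] at hholder
  calc Sop n α β γ g y
      ≤ ENNReal.ofReal (lDelta n y ^ α) *
          (coneNorm n p ν g * (ENNReal.ofReal (lDelta n y ^ (-α)) * J ^ (1 / q))) := by
        unfold Sop
        gcongr
    _ = (ENNReal.ofReal (lDelta n y ^ α) * ENNReal.ofReal (lDelta n y ^ (-α))) *
          (J ^ (1 / q) * coneNorm n p ν g) := by ring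
    _ = J ^ (1 / q) * coneNorm n p ν g := by rw [hcancel, one_mul]
    _ ≤ _ := by
        gcongr
        rw [ENNReal.le_ofReal_iff_toReal_le hJq (by positivity)]
        linarith
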